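/- arXiv:2412.00024 — 2 statements merged into one kernel-verified Lean document; each statement's English description precedes it below -/
import Mathlib

section
/- The sum over k >= 0 of (H_{3k+1} - H_k) * (-1)^k / ((3k+1) * binomial(3k,k) * 4^{k+1}) equals π²/96 + (1/8)·Re(Li_2(3/8 + i√7/8)) + (5√7/56)·Im(Li_2(3/8 + i√7/8)). -/
open Real

/-- Complex dilogarithm defined by its power series (valid for `|z| ≤ 1`). -/
noncomputable def Li2 (z : ℂ) : ℂ := ∑' k : ℕ, z ^ (k + 1) / ((k : ℂ) + 1) ^ 2

lemma aux_int (n : ℕ) : IntervalIntegrable (fun x : ℝ => x ^ n * Real.log x) MeasureTheory.volume 0 1 :=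
  intervalIntegral.intervalIntegrable_log'.continuousOn_mul (by fun_prop)

lemma aux_log (n : ℕ) : ∫ x in (0:ℝ)..1, x ^ n * Real.log x = -1 / ((n:ℝ) + 1) ^ 2 := by
  have hn : ((n:ℝ) + 1) ≠ 0 := by positivity
  have h := intervalIntegral.integral_eq_sub_of_hasDerivAt_of_le (a := (0:ℝ)) (b := 1)
    (f := fun x => x ^ n * (x * Real.log x) / (n + 1) - x ^ (n+1) / ((n:ℝ) + 1) ^ 2)
    (f' := fun x => x ^ n * Real.log x) zero_le_one ?_ ?_ (aux_int n)
  · rw [h]; simp; ring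
  · apply Continuous.continuousOn
    have := Real.continuous_mul_log
    fun_prop
  · intro x hx
    have hx0 : x ≠ 0 := hx.1.ne'
    have h1 : HasDerivAt (fun x : ℝ => x ^ (n+1) * Real.log x / (n + 1) - x ^ (n+1) / ((n:ℝ) + 1) ^ 2)
        ((((n+1 : ℕ):ℝ) * x ^ n * Real.log x + x ^ (n+1) * x⁻¹) / (n+1) - ((n+1 : ℕ):ℝ) * x ^ n / ((n:ℝ)+1)^2) x := by
      have hp := hasDerivAt_pow (n+1) x
      simp only [Nat.add_sub_cancel] at hp
      exact ((hp.mul (Real.hasDerivAt_log hx0)).div_const _).sub (hp.div_const _)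
    convert! h1 using 1
    · funext y; ring
    · push_cast
      rw [pow_succ x n]
      field_simp
      ring

lemma aux_int2 (a b : ℕ) : IntervalIntegrable (fun x : ℝ => x ^ a * (1 - x) ^ b * Real.log x) MeasureTheory.volume 0 1 :=
  intervalIntegral.intervalIntegrable_log'.continuousOn_mul (by fun_prop)

lemma aux_beta (b : ℕ) : ∀ a : ℕ, ∫ x in (0:ℝ)..1, x ^ a * (1 - x) ^ b * Real.log x =
    -((harmonic (a + b + 1) : ℝ) - (harmonic a : ℝ)) * (a.factorial * b.factorial / (a + b + 1).factorial) := by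
  induction b with
  | zero =>
    intro a
    have hn : ((a:ℝ) + 1) ≠ 0 := by positivity
    have hf : (a.factorial : ℝ) ≠ 0 := by positivity
    simp only [pow_zero, mul_one, aux_log, add_zero, harmonic_succ, Nat.factorial_succ, Nat.factorial_zero]
    push_cast
    field_simp
    ring
  | succ b ih =>
    intro a
    have h : ∫ x in (0:ℝ)..1, x ^ a * (1 - x) ^ (b+1) * Real.log x =
        (∫ x in (0:ℝ)..1, x ^ a * (1 - x) ^ b * Real.log x) - ∫ x in (0:ℝ)..1, x ^ (a+1) * (1 - x) ^ b * Real.log x := by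
      rw [← intervalIntegral.integral_sub (aux_int2 _ _) (aux_int2 _ _)]
      congr 1; funext x; ring
    rw [h, ih, ih]
    have e1 : a + 1 + b + 1 = a + b + 1 + 1 := by ring
    have e2 : a + (b + 1) + 1 = a + b + 1 + 1 := by ring
    rw [e1, e2, harmonic_succ (a + b + 1), harmonic_succ a, Nat.factorial_succ (a+b+1), Nat.factorial_succ a, Nat.factorial_succ b]
    have hn : ((a:ℝ) + 1) ≠ 0 := by positivity
    have hn2 : ((a:ℝ) + b + 1 + 1) ≠ 0 := by positivity
    have hf : (a.factorial : ℝ) ≠ 0 := by positivity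
    have hf2 : (b.factorial : ℝ) ≠ 0 := by positivity
    have hf3 : ((a+b+1).factorial : ℝ) ≠ 0 := by positivity
    push_cast
    field_simp
    ring

lemma aux_term (k : ℕ) : ((harmonic (3 * k + 1) : ℝ) - (harmonic k : ℝ)) * (-1) ^ k /
        ((3 * k + 1) * (Nat.choose (3 * k) k : ℝ) * 4 ^ (k + 1)) =
    ∫ x in (0:ℝ)..1, -((-1) ^ k / 4 ^ (k+1)) * (x ^ k * (1 - x) ^ (2 * k) * Real.log x) := by
  rw [intervalIntegral.integral_const_mul, aux_beta]
  have e : k + 2 * k + 1 = 3 * k + 1 := by ring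
  rw [e, Nat.factorial_succ]
  have hc := Nat.choose_mul_factorial_mul_factorial (n := 3 * k) (k := k) (by omega)
  have e2 : 3 * k - k = 2 * k := by omega
  rw [e2] at hc
  rw [← hc]
  have hf : (k.factorial : ℝ) ≠ 0 := by positivity
  have hf2 : ((2*k).factorial : ℝ) ≠ 0 := by positivity
  have hf3 : ((3*k).choose k : ℝ) ≠ 0 := by
    have := Nat.choose_pos (n := 3 * k) (k := k) (by omega)
    positivity
  have hk : (3 * (k:ℝ) + 1) ≠ 0 := by positivity
  push_cast
  field_simp

lemma aux_sum : HasSum (fun k : ℕ => ((harmonic (3 * k + 1) : ℝ) - (harmonic k : ℝ)) * (-1) ^ k /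
        ((3 * k + 1) * (Nat.choose (3 * k) k : ℝ) * 4 ^ (k + 1)))
    (∫ x in (0:ℝ)..1, -(Real.log x / (4 + x * (1 - x) ^ 2))) := by
  simp_rw [aux_term]
  have hq : ∀ x : ℝ, x ∈ Set.uIoc (0:ℝ) 1 → 0 ≤ x * (1-x)^2 ∧ x * (1-x)^2 ≤ 1 := by
    intro x hx
    rw [Set.uIoc_of_le zero_le_one] at hx
    have h0 := hx.1.le
    have h1 := hx.2
    refine ⟨by positivity, ?_⟩
    have : (1-x)^2 ≤ 1 := by nlinarith
    nlinarith [sq_nonneg (1-x)]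
  have hg : Summable (fun k : ℕ => ((1:ℝ)/4) ^ (k+1)) := by
    have := (summable_geometric_of_lt_one (r := (1:ℝ)/4) (by norm_num) (by norm_num)).mul_left (1/4)
    refine this.congr fun k => ?_
    rw [pow_succ']
  refine intervalIntegral.hasSum_integral_of_dominated_convergence
    (fun k x => (1/4) ^ (k+1) * |Real.log x|) ?_ ?_ ?_ ?_ ?_
  · intro k
    exact ((aux_int2 k (2*k)).const_mul _).aestronglyMeasurable_restrict_uIoc
  · intro k
    refine Filter.Eventually.of_forall fun x hx => ?_
    obtain ⟨h0, h1⟩ := hq x hx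
    have e : x ^ k * (1 - x) ^ (2 * k) = (x * (1-x)^2) ^ k := by rw [mul_pow, pow_mul]
    rw [e]
    simp only [norm_mul, norm_neg, norm_div, norm_pow, norm_one, one_pow, Real.norm_eq_abs]
    have h2 : |x| * |1 - x| ^ 2 ≤ 1 := by
      rw [← abs_pow, ← abs_mul, abs_of_nonneg h0]; exact h1
    have h3 : (|x| * |1 - x| ^ 2) ^ k ≤ 1 := pow_le_one₀ (by positivity) h2
    have h4 : |(4:ℝ)| = 4 := by norm_num
    rw [h4, one_div_pow]
    gcongr
    exact mul_le_of_le_one_left (abs_nonneg _) h3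
  · exact Filter.Eventually.of_forall fun x _ => hg.mul_right _
  · simp_rw [tsum_mul_right]
    exact intervalIntegral.intervalIntegrable_log'.abs.const_mul _
  · refine Filter.Eventually.of_forall fun x hx => ?_
    obtain ⟨h0, h1⟩ := hq x hx
    have := (hasSum_geometric_of_norm_lt_one (ξ := -(x * (1-x)^2)/4) (by
      rw [Real.norm_eq_abs, abs_lt]; constructor <;> linarith)).mul_left (-(Real.log x / 4))
    convert! this using 1
    · funext k
      rw [div_pow, neg_pow (x * (1-x)^2), mul_pow, pow_mul, pow_succ]
      ring
    · have : 4 + x * (1-x)^2 ≠ 0 := by linarith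
      have : 1 - -(x * (1-x)^2)/4 ≠ 0 := by linarith
      have e : 1 - -(x * (1-x)^2)/4 = (4 + x * (1-x)^2)/4 := by ring
      rw [e]
      field_simp

lemma aux_li_ne (w : ℂ) (hw : ‖w‖ ≤ 1) (x : ℝ) (hx : x ∈ Set.Ioo (0:ℝ) 1) : ‖w * x‖ < 1 := by
  rw [norm_mul, Complex.norm_real, Real.norm_eq_abs, abs_of_pos hx.1]
  nlinarith [hx.1, hx.2, norm_nonneg w]

lemma aux_li (w : ℂ) (hw : ‖w‖ ≤ 1) (hc : ∀ x ∈ Set.uIcc (0:ℝ) 1, 1 - w * x ≠ 0) :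
    MeasureTheory.IntegrableOn (fun x : ℝ => (Real.log x : ℂ) * (w / (1 - w * x))) (Set.Ioo 0 1) ∧
    ∫ x in Set.Ioo (0:ℝ) 1, (Real.log x : ℂ) * (w / (1 - w * x)) = - Li2 w := by
  have hi : ∀ k : ℕ, MeasureTheory.IntegrableOn (fun x : ℝ => w ^ (k+1) * ((x ^ k * Real.log x : ℝ) : ℂ)) (Set.Ioo 0 1) := by
    intro k
    have := (intervalIntegrable_iff_integrableOn_Ioo_of_le zero_le_one).1 (aux_int k)
    exact (MeasureTheory.Integrable.ofReal this).const_mul _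
  have hv : ∀ k : ℕ, ∫ x in Set.Ioo (0:ℝ) 1, x ^ k * Real.log x = -1 / ((k:ℝ) + 1) ^ 2 := by
    intro k
    rw [← aux_log, intervalIntegral.integral_of_le zero_le_one, MeasureTheory.integral_Ioc_eq_integral_Ioo]
  have hn : ∀ k : ℕ, ∫ x in Set.Ioo (0:ℝ) 1, ‖w ^ (k+1) * ((x ^ k * Real.log x : ℝ) : ℂ)‖ = ‖w‖ ^ (k+1) * (1 / ((k:ℝ) + 1) ^ 2) := by
    intro k
    have : ∀ x ∈ Set.Ioo (0:ℝ) 1, ‖w ^ (k+1) * ((x ^ k * Real.log x : ℝ) : ℂ)‖ = (- ‖w‖ ^ (k+1)) * (x ^ k * Real.log x) := by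
      intro x hx
      rw [norm_mul, norm_pow, Complex.norm_real, Real.norm_eq_abs, abs_of_nonpos]
      · ring
      · exact mul_nonpos_of_nonneg_of_nonpos (pow_nonneg hx.1.le _) (Real.log_nonpos hx.1.le hx.2.le)
    rw [MeasureTheory.setIntegral_congr_fun measurableSet_Ioo this, MeasureTheory.integral_const_mul, hv]
    ring
  have hs : Summable (fun k : ℕ => ∫ x in Set.Ioo (0:ℝ) 1, ‖w ^ (k+1) * ((x ^ k * Real.log x : ℝ) : ℂ)‖) := by
    simp_rw [hn]
    have h2 : Summable (fun k : ℕ => 1 / ((k:ℝ) + 1) ^ 2) := by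
      have := (summable_nat_add_iff 1).2 (Real.summable_one_div_nat_pow.2 (one_lt_two))
      simpa using this
    refine Summable.of_nonneg_of_le (fun k => by positivity) (fun k => ?_) h2
    exact mul_le_of_le_one_left (by positivity) (pow_le_one₀ (norm_nonneg _) hw)
  have ht : ∀ x ∈ Set.Ioo (0:ℝ) 1, ∑' k : ℕ, w ^ (k+1) * ((x ^ k * Real.log x : ℝ) : ℂ) = (Real.log x : ℂ) * (w / (1 - w * x)) := by
    intro x hx
    have := (hasSum_geometric_of_norm_lt_one (aux_li_ne w hw x hx)).mul_left ((Real.log x : ℂ) * w)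
    rw [div_eq_mul_inv, ← mul_assoc, ← this.tsum_eq]
    congr 1; funext k
    push_cast
    ring
  constructor
  · have h0 : IntervalIntegrable (fun x : ℝ => (Real.log x : ℂ)) MeasureTheory.volume 0 1 := by
      have h := (intervalIntegrable_iff_integrableOn_Ioo_of_le zero_le_one).1
        (intervalIntegral.intervalIntegrable_log' (a := 0) (b := 1))
      exact (intervalIntegrable_iff_integrableOn_Ioo_of_le zero_le_one).2
        (MeasureTheory.Integrable.ofReal h)
    refine (intervalIntegrable_iff_integrableOn_Ioo_of_le zero_le_one).1 (h0.mul_continuousOn ?_)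
    exact ContinuousOn.div (by fun_prop) (by fun_prop) hc
  · rw [← MeasureTheory.setIntegral_congr_fun measurableSet_Ioo ht,
      ← MeasureTheory.integral_tsum_of_summable_integral_norm hi hs, Li2, ← tsum_neg]
    congr 1; funext k
    rw [MeasureTheory.integral_const_mul, integral_complex_ofReal, hv]
    push_cast
    ring

lemma aux_li_neg_one : Li2 (-1) = -(π:ℂ)^2 / 12 := by
  have h := hasSum_one_div_nat_pow_mul_cos (k := 1) one_ne_zero (x := 1/2) (by constructor <;> norm_num)
  have h' := (hasSum_nat_add_iff' 1).2 h
  have hv : (Polynomial.map (algebraMap ℚ ℝ) (Polynomial.bernoulli (2 * 1))).eval (1/2) = -1/12 := by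
    simp [Polynomial.bernoulli, Finset.sum_range_succ, bernoulli_two]
    norm_num
  rw [hv] at h'
  have hc : HasSum (fun k : ℕ => (-1 : ℝ) ^ (k + 1) / ((k:ℝ) + 1) ^ 2) (-π^2/12) := by
    convert! h' using 1
    · funext k
      have e : 2 * π * ((k + 1 : ℕ):ℝ) * (1/2) = ((k + 1 : ℕ):ℝ) * π := by ring
      rw [e, Real.cos_nat_mul_pi]
      push_cast
      ring
    · simp
      ring
  have := Complex.hasSum_ofReal.2 hc
  rw [Li2]
  push_cast at this
  exact this.tsum_eq

lemma aux_li_conj (w : ℂ) : Li2 ((starRingEnd ℂ) w) = (starRingEnd ℂ) (Li2 w) := by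
  rw [Li2, Li2, Complex.conj_tsum]
  congr 1; funext k
  simp

lemma aux_pf (u x : ℂ) (hu : u^2 = -7) (h1 : 1 - (-1) * x ≠ 0) (h2 : 1 - (3+u)/8 * x ≠ 0) (h3 : 1 - (3-u)/8 * x ≠ 0)
    (h4 : 4 + x * (1-x)^2 ≠ 0) :
    -(1 / (4 + x * (1 - x)^2)) = 1/8 * (-1 / (1 - (-1) * x)) + (-7+5*u)/112 * (((3+u)/8) / (1 - (3+u)/8 * x))
      + (-7-5*u)/112 * (((3-u)/8) / (1 - (3-u)/8 * x)) := by
  have hp : (1 - (3+u)/8 * x) * (1 - (3-u)/8 * x) = (x^2-3*x+4)/4 := by linear_combination (-x^2/64) * hu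
  have hq : x^2-3*x+4 ≠ 0 := by
    intro h
    rw [h] at hp
    simp [h2, h3] at hp
  have e : (-7+5*u)/112 * (((3+u)/8) / (1 - (3+u)/8 * x))
      + (-7-5*u)/112 * (((3-u)/8) / (1 - (3-u)/8 * x)) = ((-7+5*u)/112 * ((3+u)/8) * (1 - (3-u)/8 * x) + (-7-5*u)/112 * ((3-u)/8) * (1 - (3+u)/8 * x)) / ((1 - (3+u)/8 * x) * (1 - (3-u)/8 * x)) := by
    generalize 1 - (3+u)/8 * x = A at *
    generalize 1 - (3-u)/8 * x = B at *
    field_simp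
  have e2 : (-7+5*u)/112 * ((3+u)/8) * (1 - (3-u)/8 * x) + (-7-5*u)/112 * ((3-u)/8) * (1 - (3+u)/8 * x) = (x - 4) / 32 := by
    linear_combination (10/896 - x/512) * hu
  rw [add_assoc, e, e2, hp]
  have h1' : 1 + x ≠ 0 := by simpa using h1
  have h5 : 4 + x * (1-x)^2 = (1 + x) * (x^2-3*x+4) := by ring
  have h6 : 1 - (-1) * x = 1 + x := by ring
  rw [h5, h6]
  generalize hQ : x^2-3*x+4 = Q at hq ⊢
  field_simp
  linear_combination (-32) * hQ

theorem stmt_10 :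
    ∑' k : ℕ, ((harmonic (3 * k + 1) : ℝ) - (harmonic k : ℝ)) * (-1) ^ k /
        ((3 * k + 1) * (Nat.choose (3 * k) k : ℝ) * 4 ^ (k + 1)) =
      π ^ 2 / 96 + (1 / 8) * (Li2 (3 / 8 + Complex.I * (Real.sqrt 7 / 8 : ℝ))).re +
        (5 * Real.sqrt 7 / 56) * (Li2 (3 / 8 + Complex.I * (Real.sqrt 7 / 8 : ℝ))).im := by
  rw [aux_sum.tsum_eq]
  have hs : (Real.sqrt 7) ^ 2 = 7 := Real.sq_sqrt (by norm_num)
  set s := Real.sqrt 7 with hsdef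
  set u : ℂ := Complex.I * (s : ℂ) with hu
  have hu2 : u ^ 2 = -7 := by
    have : (s:ℂ)^2 = 7 := by exact_mod_cast hs
    rw [hu, mul_pow, Complex.I_sq, this]; ring
  have hw : (3 / 8 + Complex.I * (s / 8 : ℝ) : ℂ) = (3 + u) / 8 := by
    rw [hu]; push_cast; ring
  rw [hw]
  have hconj : (3 - u) / 8 = (starRingEnd ℂ) ((3 + u) / 8) := by
    have c3 : (starRingEnd ℂ) 3 = 3 := Complex.conj_ofNat 3
    have c8 : (starRingEnd ℂ) 8 = 8 := Complex.conj_ofNat 8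
    rw [hu, map_div₀, map_add, map_mul, Complex.conj_I, Complex.conj_ofReal, c3, c8]
    ring
  have hw1 : ‖(3 + u) / 8‖ ≤ 1/2 := by
    have : ‖(3 + u) / 8‖ ^ 2 = 1/4 := by
      rw [Complex.sq_norm, Complex.normSq_apply, hu]
      simp
      linear_combination (1/64) * hs
    nlinarith [norm_nonneg ((3 + u) / 8)]
  have hv1 : ‖(3 - u) / 8‖ ≤ 1/2 := by
    rw [hconj, RCLike.norm_conj]; exact hw1
  have hne : ∀ w : ℂ, ‖w‖ ≤ 1/2 → ∀ x ∈ Set.uIcc (0:ℝ) 1, 1 - w * x ≠ 0 := by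
    intro w hw x hx h
    rw [Set.uIcc_of_le zero_le_one] at hx
    have h2 : ‖w * x‖ = 1 := by rw [← sub_eq_zero.1 h]; simp
    rw [norm_mul, Complex.norm_real, Real.norm_eq_abs, abs_of_nonneg hx.1] at h2
    nlinarith [hx.1, hx.2, norm_nonneg w]
  have hne1 : ∀ x ∈ Set.uIcc (0:ℝ) 1, 1 - (-1 : ℂ) * x ≠ 0 := by
    intro x hx h
    rw [Set.uIcc_of_le zero_le_one] at hx
    have h3 : ((1 + x : ℝ) : ℂ) = 0 := by rw [← h]; push_cast; ring
    have h4 : 1 + x = 0 := by exact_mod_cast h3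
    linarith [hx.1]
  obtain ⟨i1, v1⟩ := aux_li (-1) (by simp) hne1
  obtain ⟨i2, v2⟩ := aux_li ((3 + u) / 8) (by linarith) (hne _ hw1)
  obtain ⟨i3, v3⟩ := aux_li ((3 - u) / 8) (by linarith) (hne _ hv1)
  have key : ((∫ x in (0:ℝ)..1, -(Real.log x / (4 + x * (1 - x) ^ 2)) : ℝ) : ℂ) =
      1/8 * (-Li2 (-1)) + (-7+5*u)/112 * (-Li2 ((3 + u)/8)) + (-7-5*u)/112 * (-Li2 ((3 - u)/8)) := by
    rw [← v1, ← v2, ← v3, ← MeasureTheory.integral_const_mul, ← MeasureTheory.integral_const_mul,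
      ← MeasureTheory.integral_const_mul, ← MeasureTheory.integral_add (i1.const_mul _) (i2.const_mul _),
      ← MeasureTheory.integral_add (by exact (i1.const_mul _).add (i2.const_mul _)) (i3.const_mul _),
      intervalIntegral.integral_of_le zero_le_one, MeasureTheory.integral_Ioc_eq_integral_Ioo,
      ← integral_complex_ofReal]
    refine MeasureTheory.setIntegral_congr_fun measurableSet_Ioo fun x hx => ?_
    have hx' : x ∈ Set.uIcc (0:ℝ) 1 := by
      rw [Set.uIcc_of_le zero_le_one]; exact ⟨hx.1.le, hx.2.le⟩
    have h4 : (4 + (x:ℂ) * (1 - x)^2) ≠ 0 := by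
      have : 4 + x * (1-x)^2 ≠ 0 := by
        have := hx.1
        positivity
      exact_mod_cast this
    have := aux_pf u x hu2 (hne1 x hx') (hne _ hw1 x hx') (hne _ hv1 x hx') h4
    push_cast
    linear_combination (Real.log x : ℂ) * this
  rw [aux_li_neg_one, hconj, aux_li_conj] at key
  generalize Li2 ((3 + u) / 8) = L at key ⊢
  have := congrArg Complex.re key
  rw [Complex.ofReal_re] at this
  rw [this]
  have e1 : (1/8 * (-(-(π:ℂ)^2/12))) = ((π^2/96 : ℝ) : ℂ) := by push_cast; ring
  have e2 : (-7+5*u)/112 = (-1/16 : ℝ) + (5*s/112 : ℝ) * Complex.I := by rw [hu]; push_cast; ring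
  have e3 : (-7-5*u)/112 = (-1/16 : ℝ) - (5*s/112 : ℝ) * Complex.I := by rw [hu]; push_cast; ring
  rw [e1, e2, e3]
  simp only [Complex.add_re, Complex.sub_re, Complex.mul_re, Complex.neg_re, Complex.neg_im, Complex.conj_re, Complex.conj_im,
    Complex.ofReal_re, Complex.ofReal_im, Complex.I_re, Complex.I_im, Complex.add_im, Complex.sub_im, Complex.mul_im]
  ring
end

section
/- The sum over k >= 0 of (H_{2k} - H_k) / ((3k+1) * binomial(3k,k) * 2^{k+1}) equals (π·ln 2)/20 - (3/40)·(ln 2)² - π²/160. -/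
open Real

open MeasureTheory intervalIntegral

noncomputable def ell (x : ℝ) : ℝ := Real.log x - Real.log (1 - x)

lemma ell_int : IntervalIntegrable ell volume 0 1 := by
  unfold ell
  apply IntervalIntegrable.sub
  · exact intervalIntegrable_log'
  · have := (intervalIntegrable_log' (a := 1) (b := 0)).comp_sub_left 1
    simpa using this

lemma ell_meas : Measurable ell := by
  unfold ell
  fun_prop

lemma cont1 : Continuous fun x : ℝ => (1 - x) * Real.log (1 - x) :=
  Real.continuous_mul_log.comp (continuous_const.sub continuous_id)

noncomputable def BB (m n : ℕ) : ℝ := ∫ x in (0:ℝ)..1, x ^ m * (1 - x) ^ n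
noncomputable def LL (m n : ℕ) : ℝ := ∫ x in (0:ℝ)..1, ell x * (x ^ m * (1 - x) ^ n)

lemma LL_int (m n : ℕ) :
    IntervalIntegrable (fun x => ell x * (x ^ m * (1 - x) ^ n)) volume 0 1 :=
  ell_int.mul_continuousOn (by fun_prop)

lemma BB_int (m n : ℕ) :
    IntervalIntegrable (fun x : ℝ => x ^ m * (1 - x) ^ n) volume 0 1 :=
  Continuous.intervalIntegrable (by fun_prop) _ _

lemma LL_add (m n : ℕ) : LL m n = LL (m+1) n + LL m (n+1) := by
  unfold LL
  rw [← integral_add (LL_int _ _) (LL_int _ _)]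
  congr 1; ext x; ring

lemma BB_add (m n : ℕ) : BB m n = BB (m+1) n + BB m (n+1) := by
  unfold BB
  rw [← integral_add (BB_int _ _) (BB_int _ _)]
  congr 1; ext x; ring

lemma BB_rec (m n : ℕ) : (m+1) * BB m (n+1) - (n+1) * BB (m+1) n = 0 := by
  have h := integral_eq_sub_of_hasDerivAt_of_le (a := 0) (b := 1)
    (f := fun x : ℝ => x^(m+1) * (1-x)^(n+1))
    (f' := fun x : ℝ => (m+1) * (x^m * (1-x)^(n+1)) - (n+1) * (x^(m+1) * (1-x)^n))
    zero_le_one (by fun_prop) ?_ ?_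
  · rw [integral_sub ((BB_int _ _).const_mul _) ((BB_int _ _).const_mul _)] at h
    rw [intervalIntegral.integral_const_mul, intervalIntegral.integral_const_mul] at h
    simpa [BB] using h
  · intro x hx
    have h1 := (hasDerivAt_pow (m+1) x).mul
      (((hasDerivAt_id x).const_sub 1).pow (n+1))
    refine HasDerivAt.congr_deriv h1 ?_
    simp
    ring
  · exact ((BB_int _ _).const_mul _).sub ((BB_int _ _).const_mul _)

lemma LL_rec (m n : ℕ) : (m+1) * LL m (n+1) - (n+1) * LL (m+1) n + BB m n = 0 := by
  have h := integral_eq_sub_of_hasDerivAt_of_le (a := 0) (b := 1)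
    (f := fun x : ℝ => x^m * (1-x)^(n+1) * (x * Real.log x)
      - x^(m+1) * (1-x)^n * ((1-x) * Real.log (1-x)))
    (f' := fun x : ℝ => (m+1) * (ell x * (x^m * (1-x)^(n+1)))
      - (n+1) * (ell x * (x^(m+1) * (1-x)^n)) + x^m * (1-x)^n)
    zero_le_one ?_ ?_ ?_
  · rw [integral_add (((LL_int _ _).const_mul _).sub ((LL_int _ _).const_mul _)) (BB_int _ _),
      integral_sub ((LL_int _ _).const_mul _) ((LL_int _ _).const_mul _)] at h
    rw [intervalIntegral.integral_const_mul, intervalIntegral.integral_const_mul] at h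
    simpa [BB, LL] using h
  · apply Continuous.continuousOn
    have := cont1
    have := Real.continuous_mul_log
    fun_prop
  · intro x hx
    have hx0 : x ≠ 0 := hx.1.ne'
    have hx1 : 1 - x ≠ 0 := by have := hx.2; intro h; linarith
    have h1 := ((hasDerivAt_pow (m+1) x).mul
      (((hasDerivAt_id x).const_sub 1).pow (n+1))).mul
      ((Real.hasDerivAt_log hx0).sub (((hasDerivAt_id x).const_sub 1).log hx1))
    refine HasDerivAt.congr_deriv (h1.congr_of_eventuallyEq
      (Filter.Eventually.of_forall fun y => ?_)) ?_
    · simp; ring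
    · simp [ell]
      field_simp
      ring
  · exact (((LL_int _ _).const_mul _).sub ((LL_int _ _).const_mul _)).add (BB_int _ _)

lemma BB_succ_left (m n : ℕ) : BB (m+1) n = (m+1) / (m+n+2) * BB m n := by
  have h1 := BB_rec m n
  have h2 := BB_add m n
  have : (m:ℝ)+n+2 ≠ 0 := by positivity
  field_simp
  linear_combination h1*(-1) - (m+1)*h2

lemma BB_succ_right (m n : ℕ) : BB m (n+1) = (n+1) / (m+n+2) * BB m n := by
  have h1 := BB_rec m n
  have h2 := BB_add m n
  have : (m:ℝ)+n+2 ≠ 0 := by positivity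
  field_simp
  linear_combination h1 - (n+1)*h2

lemma LL_succ_left (m n : ℕ) : LL (m+1) n = ((m+1) * LL m n + BB m n) / (m+n+2) := by
  have h1 := LL_rec m n
  have h2 := LL_add m n
  have : (m:ℝ)+n+2 ≠ 0 := by positivity
  field_simp
  linear_combination h1*(-1) - (m+1)*h2

lemma LL_succ_right (m n : ℕ) : LL m (n+1) = ((n+1) * LL m n - BB m n) / (m+n+2) := by
  have h1 := LL_rec m n
  have h2 := LL_add m n
  have : (m:ℝ)+n+2 ≠ 0 := by positivity
  field_simp
  linear_combination h1 - (n+1)*h2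

lemma LL_zero : LL 0 0 = 0 := by
  have h : LL 0 0 = - LL 0 0 := by
    unfold LL
    have := integral_comp_sub_left (a := 0) (b := 1)
      (fun x => ell x * (x ^ 0 * (1 - x) ^ 0)) 1
    simp only [sub_self, sub_zero] at this
    refine this.symm.trans ?_
    rw [← intervalIntegral.integral_neg]
    congr 1; ext x; simp only [ell]; ring_nf
  linarith

lemma BB_eq (m n : ℕ) : BB m n = (m.factorial * n.factorial : ℝ) / (m+n+1).factorial := by
  induction m with
  | zero =>
    induction n with
    | zero => simp [BB]
    | succ n ih =>
      rw [BB_succ_right, ih]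
      have : ((0 + (n+1) + 1).factorial : ℝ) = (n+2) * (0+n+1).factorial := by
        rw [show 0 + (n+1) + 1 = (0+n+1)+1 by ring, Nat.factorial_succ]; push_cast; ring
      rw [this, Nat.factorial_succ n]
      have : ((0+n+1).factorial : ℝ) ≠ 0 := by positivity
      push_cast
      field_simp
      ring
  | succ m ih =>
    rw [BB_succ_left, ih]
    have : ((m + 1 + n + 1).factorial : ℝ) = (m+n+2) * (m+n+1).factorial := by
      rw [show m + 1 + n + 1 = (m+n+1)+1 by ring, Nat.factorial_succ]; push_cast; ring
    rw [this, Nat.factorial_succ m]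
    have : ((m+n+1).factorial : ℝ) ≠ 0 := by positivity
    push_cast
    field_simp

lemma LL_eq (m n : ℕ) : LL m n = BB m n * ((harmonic m : ℝ) - harmonic n) := by
  induction m with
  | zero =>
    induction n with
    | zero => simp [LL_zero]
    | succ n ih =>
      rw [LL_succ_right, ih, BB_succ_right, harmonic_succ]
      push_cast
      have : (n:ℝ) + 1 ≠ 0 := by positivity
      field_simp
      ring
  | succ m ih =>
    rw [LL_succ_left, ih, BB_succ_left, harmonic_succ]
    push_cast
    have : (m:ℝ) + 1 ≠ 0 := by positivity
    field_simp
    ring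

lemma term_eq (k : ℕ) : ((harmonic (2 * k) : ℝ) - (harmonic k : ℝ)) /
        ((3 * k + 1) * (Nat.choose (3 * k) k : ℝ) * 2 ^ (k + 1)) =
      ∫ x in (0:ℝ)..1, (1/2)^(k+1) * (ell x * (x ^ (2*k) * (1 - x) ^ k)) := by
  rw [intervalIntegral.integral_const_mul]
  change _ = _ * LL (2*k) k
  rw [LL_eq, BB_eq]
  have h := Nat.choose_mul_factorial_mul_factorial (show k ≤ 3*k by omega)
  rw [show 3*k - k = 2*k by omega] at h
  rw [show 2*k+k+1 = 3*k+1 by ring, Nat.factorial_succ, ← h]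
  have h1 : ((3*k).choose k : ℝ) ≠ 0 := by
    exact_mod_cast (Nat.choose_pos (show k ≤ 3*k by omega)).ne'
  have h2 : ((2*k).factorial : ℝ) ≠ 0 := by positivity
  have h3 : (k.factorial : ℝ) ≠ 0 := by positivity
  have h4 : (2:ℝ)^(k+1) * (1/2)^(k+1) = 1 := by rw [← mul_pow]; norm_num
  push_cast
  field_simp
  rw [mul_assoc, h4, mul_one]

lemma sum_eq : HasSum (fun k : ℕ => ((harmonic (2 * k) : ℝ) - (harmonic k : ℝ)) /
        ((3 * k + 1) * (Nat.choose (3 * k) k : ℝ) * 2 ^ (k + 1)))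
      (∫ x in (0:ℝ)..1, ell x / (2 - x^2*(1-x))) := by
  simp_rw [term_eq]
  have hq : ∀ x ∈ Set.uIoc (0:ℝ) 1, 0 ≤ x^2*(1-x) ∧ x^2*(1-x) ≤ 1 := by
    intro x hx
    rw [Set.uIoc_of_le zero_le_one] at hx
    have h1 : 0 ≤ 1 - x := by linarith [hx.2]
    refine ⟨by positivity, ?_⟩
    have : x^2 ≤ 1 := by nlinarith [hx.1, hx.2]
    nlinarith [hx.1, hx.2]
  have hs : ∀ c : ℝ, HasSum (fun k : ℕ => (1/2:ℝ)^(k+1) * c) c := by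
    intro c
    have := (hasSum_geometric_of_lt_one (r := (1/2:ℝ)) (by norm_num) (by norm_num)).mul_left (1/2 * c)
    rw [show (1/2 * c * (1 - 1/2)⁻¹ : ℝ) = c by norm_num; ring] at this
    refine (congrArg (fun f => HasSum f _) (funext ?_)).mp this
    intro k; ring
  refine intervalIntegral.hasSum_integral_of_dominated_convergence
    (fun k x => (1/2)^(k+1) * |ell x|) ?_ ?_ ?_ ?_ ?_
  · intro n
    have := ell_meas
    exact Measurable.aestronglyMeasurable (by fun_prop)
  · intro n
    refine Filter.Eventually.of_forall fun x hx => ?_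
    obtain ⟨h0, h1⟩ := hq x hx
    have : x^(2*n) * (1-x)^n = (x^2*(1-x))^n := by rw [mul_pow, pow_mul]
    rw [this, norm_mul, norm_mul, Real.norm_eq_abs, Real.norm_eq_abs, Real.norm_eq_abs,
      abs_of_nonneg (by positivity : (0:ℝ) ≤ (1/2)^(n+1)), abs_of_nonneg (pow_nonneg h0 n)]
    have := pow_le_one₀ (n := n) h0 h1
    gcongr
    exact mul_le_of_le_one_right (abs_nonneg _) this
  · exact Filter.Eventually.of_forall fun x hx => (hs _).summable
  · simp_rw [fun x => (hs |ell x|).tsum_eq]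
    exact ell_int.abs
  · refine Filter.Eventually.of_forall fun x hx => ?_
    obtain ⟨h0, h1⟩ := hq x hx
    have := (hasSum_geometric_of_lt_one (r := (x^2*(1-x))/2) (by positivity) (by linarith)).mul_left
      (1/2 * ell x)
    have e : ell x / (2 - x^2*(1-x)) = 1 / 2 * ell x * (1 - x ^ 2 * (1 - x) / 2)⁻¹ := by
      have : 2 - x^2*(1-x) ≠ 0 := by linarith
      have : 1 - x^2*(1-x)/2 ≠ 0 := by linarith
      field_simp
    rw [e]
    refine (congrArg (fun f => HasSum f _) (funext ?_)).mp this
    · intro k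
      rw [div_pow, mul_pow, pow_mul, one_div, inv_pow]
      field_simp
      ring

/-- denominators -/
noncomputable def DD (a : ℂ) (x : ℝ) : ℂ := x + a * (1 - x)

lemma DD_re (a : ℂ) (x : ℝ) : (DD a x).re = x + a.re * (1 - x) := by
  simp [DD]

lemma DD_pos {a : ℂ} (ha : 0 < a.re) {x : ℝ} (h0 : 0 ≤ x) (h1 : x ≤ 1) : 0 < (DD a x).re := by
  rw [DD_re]
  rcases h0.eq_or_lt with h | h
  · subst h; simpa using ha
  · have : 0 ≤ a.re * (1-x) := mul_nonneg ha.le (by linarith)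
    linarith

lemma DD_ne {a : ℂ} (ha : 0 < a.re) {x : ℝ} (h0 : 0 ≤ x) (h1 : x ≤ 1) : DD a x ≠ 0 := by
  intro h
  have := DD_pos ha h0 h1
  simp [h] at this

lemma DD_slit {a : ℂ} (ha : 0 < a.re) {x : ℝ} (h0 : 0 ≤ x) (h1 : x ≤ 1) :
    DD a x ∈ Complex.slitPlane := Or.inl (DD_pos ha h0 h1)

lemma DD_cont (a : ℂ) : Continuous (DD a) := by unfold DD; fun_prop

lemma ellC_int : IntervalIntegrable (fun x => (ell x : ℂ)) volume 0 1 := by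
  have := ell_int
  rw [intervalIntegrable_iff] at this ⊢
  exact this.ofReal

lemma J'_int {a : ℂ} (ha : 0 < a.re) :
    IntervalIntegrable (fun x => (ell x : ℂ) * (1 / (DD a x)^2)) volume 0 1 := by
  apply ellC_int.mul_continuousOn
  rw [Set.uIcc_of_le zero_le_one]
  apply ContinuousOn.div continuousOn_const ((DD_cont a).pow 2).continuousOn
  intro x hx
  exact pow_ne_zero 2 (DD_ne ha hx.1 hx.2)

lemma J_int {a : ℂ} (ha : 0 < a.re) (c : ℂ) :
    IntervalIntegrable (fun x => (ell x : ℂ) * (c / (DD a x))) volume 0 1 := by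
  apply ellC_int.mul_continuousOn
  rw [Set.uIcc_of_le zero_le_one]
  apply ContinuousOn.div continuousOn_const (DD_cont a).continuousOn
  intro x hx
  exact (DD_ne ha hx.1 hx.2)

lemma J'_eq {a : ℂ} (ha : 0 < a.re) :
    ∫ x in (0:ℝ)..1, (ell x : ℂ) * (1 / (DD a x)^2) = Complex.log a / a := by
  have ha0 : a ≠ 0 := by rintro rfl; simp at ha
  rw [integral_eq_sub_of_hasDerivAt_of_le (a := 0) (b := 1)
    (f := fun x : ℝ => (1/a) * (((x * Real.log x : ℝ) : ℂ) / DD a x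
      + a * (((1-x) * Real.log (1-x) : ℝ) : ℂ) / DD a x - Complex.log (DD a x)))
    zero_le_one ?_ ?_ (J'_int ha)]
  · simp [DD]; ring
  · have hD : ContinuousOn (DD a) (Set.Icc 0 1) := (DD_cont a).continuousOn
    have hn : ∀ x ∈ Set.Icc (0:ℝ) 1, DD a x ≠ 0 := fun x hx => DD_ne ha hx.1 hx.2
    have c1 : ContinuousOn (fun x : ℝ => ((x * Real.log x : ℝ) : ℂ)) (Set.Icc 0 1) :=
      (Complex.continuous_ofReal.comp Real.continuous_mul_log).continuousOn
    have c2 : ContinuousOn (fun x : ℝ => (((1-x) * Real.log (1-x) : ℝ) : ℂ)) (Set.Icc 0 1) :=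
      (Complex.continuous_ofReal.comp cont1).continuousOn
    exact continuousOn_const.mul (((c1.div hD hn).add
      ((continuousOn_const.mul c2).div hD hn)).sub
        (hD.clog fun x hx => DD_slit ha hx.1 hx.2))
  · intro x hx
    have hx0 : x ≠ 0 := hx.1.ne'
    have hx1 : 1 - x ≠ 0 := by have := hx.2; intro h; linarith
    have hn := DD_ne ha hx.1.le hx.2.le
    have d0 : HasDerivAt (DD a) (1 - a) x := by
      have h1 : HasDerivAt (fun x : ℝ => (x : ℂ)) 1 x := by
        simpa using (hasDerivAt_id x).ofReal_comp
      have := h1.add ((h1.const_sub 1).const_mul a)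
      refine HasDerivAt.congr_deriv this ?_
      ring
    have d1 : HasDerivAt (fun x : ℝ => ((x * Real.log x : ℝ) : ℂ))
        ((Real.log x + 1 : ℝ) : ℂ) x := (Real.hasDerivAt_mul_log hx0).ofReal_comp
    have d2 : HasDerivAt (fun x : ℝ => (((1-x) * Real.log (1-x) : ℝ) : ℂ))
        ((-(Real.log (1-x) + 1) : ℝ) : ℂ) x := by
      apply HasDerivAt.ofReal_comp
      have := (Real.hasDerivAt_mul_log hx1).comp x ((hasDerivAt_id x).const_sub 1)
      refine HasDerivAt.congr_deriv this ?_
      simp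
    have := (((d1.div d0 hn).add ((d2.const_mul a).div d0 hn)).sub
      (d0.clog_real (DD_slit ha hx.1.le hx.2.le))).const_mul (1/a)
    refine HasDerivAt.congr_deriv this ?_
    field_simp
    simp only [ell, DD]
    push_cast
    ring

noncomputable def J (a : ℂ) : ℂ := ∫ x in (0:ℝ)..1, (ell x : ℂ) * ((1 - a) / (DD a x))

lemma J_deriv {a : ℂ} (ha : 0 < a.re) : HasDerivAt J (-(Complex.log a / a)) a := by
  rw [← J'_eq ha, ← intervalIntegral.integral_neg]
  set e : ℝ := min 1 (a.re / 2) with he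
  have he0 : 0 < e := by rw [he]; positivity
  have key : ∀ b : ℂ, a.re / 2 < b.re → ∀ x ∈ Set.uIoc (0:ℝ) 1, e ≤ (DD b x).re := by
    intro b hb x hx
    rw [Set.uIoc_of_le zero_le_one] at hx
    rw [DD_re]
    have h1 : e ≤ 1 := min_le_left _ _
    have h2 : e ≤ b.re := (min_le_right _ _).trans hb.le
    nlinarith [hx.1, hx.2]
  have hm := ell_meas
  refine (intervalIntegral.hasDerivAt_integral_of_dominated_loc_of_deriv_le
    (F := fun a x => (ell x : ℂ) * ((1 - a) / (DD a x)))
    (F' := fun a x => -((ell x : ℂ) * (1 / (DD a x)^2)))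
    (s := {b : ℂ | a.re / 2 < b.re}) (bound := fun x => |ell x| * (1 / e^2))
    ((Complex.isOpen_re_gt _).mem_nhds (by simpa using ha)) ?_ (J_int ha _) ?_ ?_ ?_ ?_).2
  · refine Filter.Eventually.of_forall fun b => ?_
    have := (DD_cont b).measurable
    exact Measurable.aestronglyMeasurable (by fun_prop)
  · have := (DD_cont a).measurable
    exact Measurable.aestronglyMeasurable (by fun_prop)
  · refine Filter.Eventually.of_forall fun x hx b hb => ?_
    have h1 := key b hb x hx
    have h2 : e ≤ ‖DD b x‖ := h1.trans (Complex.re_le_norm _)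
    rw [norm_neg, norm_mul, norm_div, norm_pow, norm_one, Complex.norm_real, Real.norm_eq_abs]
    gcongr
  · exact ell_int.abs.mul_const _
  · refine Filter.Eventually.of_forall fun x hx b hb => ?_
    have h1 := key b hb x hx
    have hn : DD b x ≠ 0 := by
      intro h; rw [h] at h1; simp at h1; linarith
    have d0 : HasDerivAt (fun b => DD b x) (1 - (x:ℂ)) b := by
      unfold DD
      simpa using ((hasDerivAt_id b).mul_const (1 - (x:ℂ))).const_add (x:ℂ)
    have := ((((hasDerivAt_id b).const_sub 1).div d0 hn)).const_mul (ell x : ℂ)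
    refine HasDerivAt.congr_deriv this ?_
    simp only [id]
    field_simp
    simp only [DD]
    ring

lemma J_eq {a : ℂ} (ha : 0 < a.re) : J a = - (Complex.log a)^2 / 2 := by
  have hd : ∀ b ∈ {b : ℂ | 0 < b.re},
      HasDerivAt (fun b => J b + (Complex.log b)^2/2) 0 b := by
    intro b hb
    have h := (J_deriv hb).add (((Complex.hasDerivAt_log (Or.inl hb)).pow 2).div_const 2)
    refine HasDerivAt.congr_deriv h ?_
    simp
    ring
  have := (Complex.isOpen_re_gt 0).is_const_of_deriv_eq_zero
    (convex_halfSpace_re_gt 0).isPreconnected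
    (fun b hb => (hd b hb).differentiableAt.differentiableWithinAt)
    (fun b hb => (hd b hb).deriv) (show a ∈ {b : ℂ | 0 < b.re} from ha)
    (show (1:ℂ) ∈ {b : ℂ | 0 < b.re} by simp)
  simp [J] at this
  simp only [J]
  linear_combination this

lemma log_one_add_I : Complex.log (1 + Complex.I) = Real.log 2 / 2 + π / 4 * Complex.I := by
  have h : (1 + Complex.I) = Complex.exp (Real.log 2 / 2 + π / 4 * Complex.I) := by
    rw [Complex.exp_add, Complex.exp_mul_I]
    have h1 : Complex.exp (Real.log 2 / 2) = (√2 : ℝ) := by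
      rw [← Real.exp_log (show 0 < √2 by positivity), Real.log_sqrt (by norm_num)]
      push_cast; rfl
    have h2 : Complex.cos (π/4) = (√2/2 : ℝ) := by
      rw [← Real.cos_pi_div_four]; push_cast; rfl
    have h3 : Complex.sin (π/4) = (√2/2 : ℝ) := by
      rw [← Real.sin_pi_div_four]; push_cast; rfl
    rw [h1, h2, h3]
    have : ((√2:ℝ):ℂ) * (√2:ℝ) = 2 := by
      rw [← Complex.ofReal_mul, Real.mul_self_sqrt (by norm_num)]; norm_num
    push_cast
    linear_combination (-(1 + Complex.I)/2) * this
  have him : ((Real.log 2 : ℂ) / 2 + π / 4 * Complex.I).im = π / 4 := by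
    have : ((Real.log 2 : ℂ) / 2 + π / 4 * Complex.I)
        = ((Real.log 2 / 2 : ℝ) : ℂ) + ((π / 4 : ℝ) : ℂ) * Complex.I := by push_cast; rfl
    rw [this]
    simp only [Complex.add_im, Complex.ofReal_im, Complex.re_ofReal_mul, Complex.im_ofReal_mul,
      Complex.I_im]
    ring
  rw [h, Complex.log_exp]
  · rw [him]; linarith [Real.pi_pos]
  · rw [him]; linarith [Real.pi_pos]

lemma log_one_sub_I : Complex.log (1 - Complex.I) = Real.log 2 / 2 - π / 4 * Complex.I := by
  have h : (1 - Complex.I) = (starRingEnd ℂ) (1 + Complex.I) := by simp; ring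
  rw [h, Complex.log_conj, log_one_add_I]
  · rw [map_add, map_mul, map_div₀, map_div₀, Complex.conj_ofReal, Complex.conj_ofReal,
      Complex.conj_I, map_ofNat, map_ofNat]
    ring
  · exact Complex.slitPlane_arg_ne_pi (Or.inl (by simp))

lemma final : (∫ x in (0:ℝ)..1, ell x / (2 - x^2*(1-x))) =
    π * Real.log 2 / 20 - (3 / 40) * (Real.log 2) ^ 2 - π ^ 2 / 160 := by
  have r1 : (0:ℝ) < (1/2 : ℂ).re := by norm_num
  have r2 : 0 < (1 + Complex.I).re := by simp
  have r3 : 0 < (1 - Complex.I).re := by simp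
  have h : ((∫ x in (0:ℝ)..1, ell x / (2 - x^2*(1-x)) : ℝ) : ℂ) =
      1/5 * (J (1/2) + (-1/2 + Complex.I) * J (1 + Complex.I)
        + (-1/2 - Complex.I) * J (1 - Complex.I)) := by
    unfold J
    rw [← intervalIntegral.integral_const_mul, ← intervalIntegral.integral_const_mul,
      ← integral_add (J_int r1 _) ((J_int r2 _).const_mul _),
      ← integral_add ((J_int r1 _).add ((J_int r2 _).const_mul _)) ((J_int r3 _).const_mul _),
      ← intervalIntegral.integral_const_mul, ← intervalIntegral.integral_ofReal]
    apply intervalIntegral.integral_congr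
    intro x hx
    rw [Set.uIcc_of_le zero_le_one] at hx
    have n1 := DD_ne r1 hx.1 hx.2
    have n2 := DD_ne r2 hx.1 hx.2
    have n3 := DD_ne r3 hx.1 hx.2
    have hfac : ((2:ℂ) - x^2*(1-x)) = 2 * DD (1/2) x * DD (1 + Complex.I) x * DD (1 - Complex.I) x := by
      simp only [DD]
      ring_nf
      simp only [Complex.I_sq]
      ring
    have hpf : (1:ℂ) / (2 - x^2*(1-x)) = 1/5 * ((1-1/2) / DD (1/2) x
        + (-1/2 + Complex.I) * ((1 - (1 + Complex.I)) / DD (1 + Complex.I) x)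
        + (-1/2 - Complex.I) * ((1 - (1 - Complex.I)) / DD (1 - Complex.I) x)) := by
      rw [hfac]
      field_simp
      simp only [DD]
      ring_nf
      simp only [Complex.I_sq, show Complex.I^3 = -Complex.I by rw [pow_succ, Complex.I_sq]; ring,
        Complex.I_pow_four]
      ring
    simp only
    push_cast
    rw [div_eq_mul_one_div, hpf]
    ring
  rw [J_eq r1, J_eq r2, J_eq r3, log_one_add_I, log_one_sub_I] at h
  have hl : Complex.log (1/2) = -(Real.log 2 : ℂ) := by
    have : (1/2 : ℂ) = ((1/2 : ℝ) : ℂ) := by push_cast; rfl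
    rw [this, ← Complex.ofReal_log (by norm_num), one_div, Real.log_inv]
    push_cast; rfl
  rw [hl] at h
  apply Complex.ofReal_injective
  rw [h]
  push_cast
  ring_nf
  simp only [Complex.I_sq]
  ring

theorem stmt_16 :
    ∑' k : ℕ, ((harmonic (2 * k) : ℝ) - (harmonic k : ℝ)) /
        ((3 * k + 1) * (Nat.choose (3 * k) k : ℝ) * 2 ^ (k + 1)) =
      π * Real.log 2 / 20 - (3 / 40) * (Real.log 2) ^ 2 - π ^ 2 / 160 := by
  rw [sum_eq.tsum_eq, final]
end
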